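/- Suppose (u,J) ∈ Z × Y solves the coupled kernel problem and (u_h,J_h) ∈ Z_h × Y_h solves the discrete coupled kernel problem. Then for every (u_I,J_I) ∈ Z_h × Y_h, writing E_u := u_h − u_I, E_J := J_h − J_I and C_min^h := min(α_h,η_h), one has (C_min^h − δ_h‖u_h‖)·(‖E_u‖² + ‖E_J‖²)^{1/2} ≤ T, where T := sup_{0≠v∈Z_h}|F_h(v) − F(v)|/‖v‖ + sup_{0≠K∈Y_h}|G_h(K) − G(K)|/‖K‖ + sup_{0≠v∈Z_h}|a(u,v) − a_h(u_I,v)|/‖v‖ + sup_{0≠K∈Y_h}|e(J,K) − e_h(J_I,K)|/‖K‖ + sup_{0≠v∈Z_h}|c(u,u,v) − c_h(u,u,v)|/‖v‖ + δ_h‖u − u_I‖·(‖u‖ + ‖u_h‖) + sup_{0≠v∈Z_h}|d_h(J_I,v) − d(J,v)|/‖v‖ + sup_{0≠K∈Y_h}|d(K,u) − d_h(K,u_I)|/‖K‖ (all suprema assumed finite). Moreover, if μ_h := δ_h·R_h·(C_min^h)^{−2} < 1 with R_h := (‖F_h‖_{Z_h*}² + ‖G_h‖_{Y_h*}²)^{1/2},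 then since C_min^h·(‖u_h‖² + ‖J_h‖²)^{1/2} ≤ R_h, it follows that (1 − μ_h)·C_min^h·(‖E_u‖² + ‖E_J‖²)^{1/2} ≤ T. -/

import Mathlib

theorem sup_aux {V : Type*} [NormedAddCommGroup V] (f : V → ℝ) (h0 : f 0 = 0)
    (hb : BddAbove (Set.range fun v : {v : V // v ≠ 0} => |f (v : V)| / ‖(v : V)‖))
    (S : ℝ) (w : V) (hw : ‖w‖ ≤ S) :
    f w ≤ (⨆ v : {v : V // v ≠ 0}, |f (v : V)| / ‖(v : V)‖) * S := by
  have hn : 0 ≤ (⨆ v : {v : V // v ≠ 0}, |f (v : V)| / ‖(v : V)‖) :=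
    Real.iSup_nonneg fun v => by positivity
  refine le_trans ?_ (mul_le_mul_of_nonneg_left hw hn)
  by_cases hw0 : w = 0
  · subst hw0
    simp [h0]
  · have h1 := le_ciSup hb ⟨w, hw0⟩
    have hp : 0 < ‖w‖ := norm_pos_iff.mpr hw0
    have h2 := (div_le_iff₀ hp).1 h1
    exact (le_abs_self _).trans h2

set_option maxHeartbeats 1000000 in

/-- abstract quasi-optimal error bound for the velocity/current
density (Theorem 5.1, estimate (41), before interpolation estimates).
With `E_u := u_h - u_I`, `E_J := J_h - J_I`, `C_min^h := min α_h η_h` and `T`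
the sum of the eight consistency terms (six suprema, assumed finite, plus the
two nonlinear terms), one has
`(C_min^h - δ_h ‖u_h‖) * sqrt(‖E_u‖² + ‖E_J‖²) ≤ T`; moreover if
`μ_h := δ_h R_h (C_min^h)⁻² < 1` with `R_h := sqrt(‖F_h‖² + ‖G_h‖²)`, then
`(1 - μ_h) * C_min^h * sqrt(‖E_u‖² + ‖E_J‖²) ≤ T`. -/
theorem stmt_9
    {Z Y : Type*}
    [NormedAddCommGroup Z] [InnerProductSpace ℝ Z] [CompleteSpace Z]
    [NormedAddCommGroup Y] [InnerProductSpace ℝ Y] [CompleteSpace Y]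
    (a : Z →ₗ[ℝ] Z →ₗ[ℝ] ℝ) (e : Y →ₗ[ℝ] Y →ₗ[ℝ] ℝ)
    (d : Y →ₗ[ℝ] Z →ₗ[ℝ] ℝ) (c : Z →ₗ[ℝ] Z →ₗ[ℝ] Z →ₗ[ℝ] ℝ)
    (F : Z →L[ℝ] ℝ) (G : Y →L[ℝ] ℝ)
    (Zh : Submodule ℝ Z) (Yh : Submodule ℝ Y)
    (ah : Zh →ₗ[ℝ] Zh →ₗ[ℝ] ℝ) (eh : Yh →ₗ[ℝ] Yh →ₗ[ℝ] ℝ)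
    (dh : Yh →ₗ[ℝ] Zh →ₗ[ℝ] ℝ) (ch : Z →ₗ[ℝ] Z →ₗ[ℝ] Z →ₗ[ℝ] ℝ)
    (Fh : Zh →L[ℝ] ℝ) (Gh : Yh →L[ℝ] ℝ)
    (αh ηh δh : ℝ) (hαh : 0 < αh) (hηh : 0 < ηh) (hδh : 0 < δh)
    (hah : ∀ v : Zh, αh * ‖v‖ ^ 2 ≤ ah v v)
    (heh : ∀ K : Yh, ηh * ‖K‖ ^ 2 ≤ eh K K)
    (hchskew : ∀ u w : Z, ch u w w = 0)
    (hchbdd : ∀ u v w : Z, |ch u v w| ≤ δh * ‖u‖ * ‖v‖ * ‖w‖)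
    (u : Z) (J : Y)
    (hu : ∀ v : Z, a u v + c u u v - d J v = F v)
    (hJ : ∀ K : Y, e J K + d K u = G K)
    (uh : Zh) (Jh : Yh)
    (huh : ∀ v : Zh, ah uh v + ch (uh : Z) (uh : Z) (v : Z) - dh Jh v = Fh v)
    (hJh : ∀ K : Yh, eh Jh K + dh K uh = Gh K)
    (uI : Zh) (JI : Yh)
    (hbdd₁ : BddAbove (Set.range fun v : {v : Zh // v ≠ 0} =>
        |Fh (v : Zh) - F ((v : Zh) : Z)| / ‖(v : Zh)‖))
    (hbdd₂ : BddAbove (Set.range fun K : {K : Yh // K ≠ 0} =>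
        |Gh (K : Yh) - G ((K : Yh) : Y)| / ‖(K : Yh)‖))
    (hbdd₃ : BddAbove (Set.range fun v : {v : Zh // v ≠ 0} =>
        |a u ((v : Zh) : Z) - ah uI (v : Zh)| / ‖(v : Zh)‖))
    (hbdd₄ : BddAbove (Set.range fun K : {K : Yh // K ≠ 0} =>
        |e J ((K : Yh) : Y) - eh JI (K : Yh)| / ‖(K : Yh)‖))
    (hbdd₅ : BddAbove (Set.range fun v : {v : Zh // v ≠ 0} =>
        |c u u ((v : Zh) : Z) - ch u u ((v : Zh) : Z)| / ‖(v : Zh)‖))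
    (hbdd₆ : BddAbove (Set.range fun v : {v : Zh // v ≠ 0} =>
        |dh JI (v : Zh) - d J ((v : Zh) : Z)| / ‖(v : Zh)‖))
    (hbdd₇ : BddAbove (Set.range fun K : {K : Yh // K ≠ 0} =>
        |d ((K : Yh) : Y) u - dh (K : Yh) uI| / ‖(K : Yh)‖))
    (T : ℝ)
    (hT : T =
        (⨆ v : {v : Zh // v ≠ 0},
            |Fh (v : Zh) - F ((v : Zh) : Z)| / ‖(v : Zh)‖)
      + (⨆ K : {K : Yh // K ≠ 0},
            |Gh (K : Yh) - G ((K : Yh) : Y)| / ‖(K : Yh)‖)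
      + (⨆ v : {v : Zh // v ≠ 0},
            |a u ((v : Zh) : Z) - ah uI (v : Zh)| / ‖(v : Zh)‖)
      + (⨆ K : {K : Yh // K ≠ 0},
            |e J ((K : Yh) : Y) - eh JI (K : Yh)| / ‖(K : Yh)‖)
      + (⨆ v : {v : Zh // v ≠ 0},
            |c u u ((v : Zh) : Z) - ch u u ((v : Zh) : Z)| / ‖(v : Zh)‖)
      + δh * ‖u - (uI : Z)‖ * (‖u‖ + ‖(uh : Z)‖)
      + (⨆ v : {v : Zh // v ≠ 0},
            |dh JI (v : Zh) - d J ((v : Zh) : Z)| / ‖(v : Zh)‖)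
      + (⨆ K : {K : Yh // K ≠ 0},
            |d ((K : Yh) : Y) u - dh (K : Yh) uI| / ‖(K : Yh)‖)) :
    (min αh ηh - δh * ‖(uh : Z)‖)
        * Real.sqrt (‖uh - uI‖ ^ 2 + ‖Jh - JI‖ ^ 2) ≤ T ∧
    (δh * Real.sqrt (‖Fh‖ ^ 2 + ‖Gh‖ ^ 2) / (min αh ηh) ^ 2 < 1 →
      (1 - δh * Real.sqrt (‖Fh‖ ^ 2 + ‖Gh‖ ^ 2) / (min αh ηh) ^ 2)
          * min αh ηh
          * Real.sqrt (‖uh - uI‖ ^ 2 + ‖Jh - JI‖ ^ 2) ≤ T) := by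
  have hm : 0 < min αh ηh := lt_min hαh hηh
  set m := min αh ηh with hmdef
  have hmα : m ≤ αh := min_le_left _ _
  have hmη : m ≤ ηh := min_le_right _ _
  clear_value m
  have key : (m - δh * ‖(uh : Z)‖) * Real.sqrt (‖uh - uI‖ ^ 2 + ‖Jh - JI‖ ^ 2) ≤ T := by
    obtain ⟨E, hE⟩ : ∃ E, E = uh - uI := ⟨_, rfl⟩
    obtain ⟨K, hK⟩ : ∃ K, K = Jh - JI := ⟨_, rfl⟩
    rw [← hE, ← hK]
    have huhE : uh = uI + E := by rw [hE]; abel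
    have hJhK : Jh = JI + K := by rw [hK]; abel
    have hS2 : Real.sqrt (‖E‖ ^ 2 + ‖K‖ ^ 2) ^ 2 = ‖E‖ ^ 2 + ‖K‖ ^ 2 :=
      Real.sq_sqrt (by positivity)
    have hS0 := Real.sqrt_nonneg (‖E‖ ^ 2 + ‖K‖ ^ 2)
    set S := Real.sqrt (‖E‖ ^ 2 + ‖K‖ ^ 2) with hS
    clear_value S
    have hES : ‖E‖ ≤ S := abs_le_of_sq_le_sq' (by nlinarith [sq_nonneg ‖K‖]) hS0 |>.2
    have hKS : ‖K‖ ≤ S := abs_le_of_sq_le_sq' (by nlinarith [sq_nonneg ‖E‖]) hS0 |>.2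
    have b1 := sup_aux (fun v : Zh => Fh v - F (v : Z)) (by simp) hbdd₁ S E hES
    have b2 := sup_aux (fun v : Yh => Gh v - G (v : Y)) (by simp) hbdd₂ S K hKS
    have b3 := sup_aux (fun v : Zh => a u (v : Z) - ah uI v) (by simp) hbdd₃ S E hES
    have b4 := sup_aux (fun v : Yh => e J (v : Y) - eh JI v) (by simp) hbdd₄ S K hKS
    have b5 := sup_aux (fun v : Zh => c u u (v : Z) - ch u u (v : Z)) (by simp) hbdd₅ S E hES
    have b6 := sup_aux (fun v : Zh => dh JI v - d J (v : Z)) (by simp) hbdd₆ S E hES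
    have b7 := sup_aux (fun v : Yh => d (v : Y) u - dh v uI) (by simp) hbdd₇ S K hKS
    have hT0 : 0 ≤ T := by
      rw [hT]
      have p1 : 0 ≤ δh * ‖u - (uI : Z)‖ * (‖u‖ + ‖(uh : Z)‖) := by positivity
      refine add_nonneg (add_nonneg (add_nonneg (add_nonneg (add_nonneg (add_nonneg
        (add_nonneg ?_ ?_) ?_) ?_) ?_) p1) ?_) ?_ <;>
      exact Real.iSup_nonneg fun v => by positivity
    have n1 : ch u (u - uI) E ≤ δh * ‖u‖ * ‖u - (uI : Z)‖ * S :=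
      ((le_abs_self _).trans (hchbdd _ _ _)).trans
        (mul_le_mul_of_nonneg_left hES (by positivity))
    have n2 : ch (u - uI) uh E ≤ δh * ‖u - (uI : Z)‖ * ‖(uh : Z)‖ * S :=
      ((le_abs_self _).trans (hchbdd _ _ _)).trans
        (mul_le_mul_of_nonneg_left hES (by positivity))
    have n3 : -ch E uh E ≤ δh * ‖(uh : Z)‖ * S ^ 2 := by
      refine ((neg_le_abs _).trans (hchbdd _ _ _)).trans ?_
      have : δh * ‖(E : Z)‖ * ‖(uh : Z)‖ * ‖(E : Z)‖ = δh * ‖(uh : Z)‖ * ‖E‖ ^ 2 := by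
        rw [Submodule.norm_coe]; ring
      rw [this]
      gcongr
    have nl : ch u u E - ch uh uh E
        = ch u (u - uI) E + ch (u - uI) uh E - ch E uh E := by
      have h1 := hchskew u E
      have h2 : (uh : Z) = uI + E := by rw [huhE]; rfl
      have h3 : (uI : Z) = uh - E := by rw [h2]; abel
      rw [h3]
      simp only [map_sub, LinearMap.sub_apply]
      linarith
    have q1 := huh E
    have q2 := hJh K
    have q3 := hu E
    have q4 := hJ K
    have q5 : ah uh E = ah uI E + ah E E := by rw [huhE]; simp
    have q6 : eh Jh K = eh JI K + eh K K := by rw [hJhK]; simp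
    have q7 : dh Jh E = dh JI E + dh K E := by rw [hJhK]; simp
    have q8 : dh K uh = dh K uI + dh K E := by rw [huhE]; simp
    have c1 := hah E
    have c2 := heh K
    have c3 : m * ‖E‖ ^ 2 ≤ αh * ‖E‖ ^ 2 := by gcongr
    have c4 : m * ‖K‖ ^ 2 ≤ ηh * ‖K‖ ^ 2 := by gcongr
    have c5 : m * S ^ 2 = m * ‖E‖ ^ 2 + m * ‖K‖ ^ 2 := by rw [hS2]; ring
    have fin : (m - δh * ‖(uh : Z)‖) * S * S ≤ T * S := by
      have g1 : (m - δh * ‖(uh : Z)‖) * S * S = m * S ^ 2 - δh * ‖(uh : Z)‖ * S ^ 2 := by ring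
      have g2 : m * S ^ 2 ≤ ah E E + eh K K := by linarith only [c1, c2, c3, c4, c5]
      have g3 : ah E E + eh K K = (Fh E - F E) + (Gh K - G K) + (a u E - ah uI E)
          + (e J K - eh JI K) + (c u u E - ch u u E) + (ch u u E - ch uh uh E)
          + (dh JI E - d J E) + (d K u - dh K uI) := by
        linarith only [q1, q2, q3, q4, q5, q6, q7, q8]
      have g4 : ch u u E - ch uh uh E ≤ δh * ‖u - (uI : Z)‖ * (‖u‖ + ‖(uh : Z)‖) * S
          + δh * ‖(uh : Z)‖ * S ^ 2 := by
        rw [nl]; linarith only [n1, n2, n3]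
      rw [g1, sub_le_iff_le_add]
      refine g2.trans ?_
      rw [g3]
      have g5 := add_le_add (add_le_add (add_le_add (add_le_add (add_le_add (add_le_add
        (add_le_add b1 b2) b3) b4) b5) g4) b6) b7
      refine g5.trans (le_of_eq ?_)
      rw [hT]
      ring
    rcases hS0.eq_or_lt with h | h
    · rw [← h]; simpa using hT0
    · exact le_of_mul_le_mul_right fin h
  refine ⟨key, fun _ => le_trans ?_ key⟩
  refine mul_le_mul_of_nonneg_right ?_ (Real.sqrt_nonneg _)
  have hR2 : Real.sqrt (‖Fh‖ ^ 2 + ‖Gh‖ ^ 2) ^ 2 = ‖Fh‖ ^ 2 + ‖Gh‖ ^ 2 :=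
    Real.sq_sqrt (by positivity)
  have hR0 := Real.sqrt_nonneg (‖Fh‖ ^ 2 + ‖Gh‖ ^ 2)
  set R := Real.sqrt (‖Fh‖ ^ 2 + ‖Gh‖ ^ 2)
  clear_value R
  have hRu : m * ‖(uh : Z)‖ ≤ R := by
    rw [Submodule.norm_coe]
    have q1 := huh uh
    have q2 := hJh Jh
    rw [hchskew] at q1
    have c1 := hah uh
    have c2 := heh Jh
    have c3 : m * ‖uh‖ ^ 2 ≤ αh * ‖uh‖ ^ 2 := by gcongr
    have c4 : m * ‖Jh‖ ^ 2 ≤ ηh * ‖Jh‖ ^ 2 := by gcongr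
    have f1 : Fh uh ≤ ‖Fh‖ * ‖uh‖ := (le_abs_self _).trans (Fh.le_opNorm uh)
    have f2 : Gh Jh ≤ ‖Gh‖ * ‖Jh‖ := (le_abs_self _).trans (Gh.le_opNorm Jh)
    have s : m * (‖uh‖ ^ 2 + ‖Jh‖ ^ 2) ≤ ‖Fh‖ * ‖uh‖ + ‖Gh‖ * ‖Jh‖ := by linarith
    have hN2 : Real.sqrt (‖uh‖ ^ 2 + ‖Jh‖ ^ 2) ^ 2 = ‖uh‖ ^ 2 + ‖Jh‖ ^ 2 :=
      Real.sq_sqrt (by positivity)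
    have hN0 := Real.sqrt_nonneg (‖uh‖ ^ 2 + ‖Jh‖ ^ 2)
    set N := Real.sqrt (‖uh‖ ^ 2 + ‖Jh‖ ^ 2)
    clear_value N
    have huN : ‖uh‖ ≤ N := abs_le_of_sq_le_sq' (by nlinarith [sq_nonneg ‖Jh‖]) hN0 |>.2
    have cs : ‖Fh‖ * ‖uh‖ + ‖Gh‖ * ‖Jh‖ ≤ R * N := by
      refine abs_le_of_sq_le_sq' ?_ (by positivity) |>.2
      rw [mul_pow, hR2, hN2]
      nlinarith [sq_nonneg (‖Fh‖ * ‖Jh‖ - ‖Gh‖ * ‖uh‖)]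
    refine (mul_le_mul_of_nonneg_left huN hm.le).trans ?_
    rcases hN0.eq_or_lt with h | h
    · rw [← h]; simpa using hR0
    · refine le_of_mul_le_mul_right ?_ h
      rw [← hN2] at s
      linarith
  have e1 : (1 - δh * R / m ^ 2) * m = m - δh * (R / m) := by
    field_simp
  rw [e1]
  have : ‖(uh : Z)‖ ≤ R / m := (le_div_iff₀ hm).2 (by linarith)
  have := mul_le_mul_of_nonneg_left this hδh.le
  linarith
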